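/- Let R = ℚ × ∏_p ℤ/pℤ, the product of ℚ with the rings ℤ/pℤ over all primes p. An element x = (q, (a_p)_p) of R is absolute if and only if the set of primes p for which a_p · (s mod p) ≠ (r mod p) is finite, where q = r/s is written as a fraction of integers with s ≠ 0; equivalently, the core of R consists precisely of those elements (r/s, (a_p)_p) such that a_p equals r/s modulo p for all but finitely many primes p (this condition being well-defined for all primes p not dividing s, of which there are all but finitely many). -/

import Mathlib

/-- A weak inverse of an integer in a commutative ring has the same image under any two ring
homomorphisms. -/
theorem map_eq_map_of_weak_inverse {R S : Type*} [CommRing R] [CommRing S] (f g : R →+* S)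
    (n : ℤ) (v : R) (hn : n * v * n = n) (hv : v * n * v = v) : f v = g v := by
  have hfn := congrArg f hn
  have hfv := congrArg f hv
  have hgn := congrArg g hn
  have hgv := congrArg g hv
  simp only [map_mul, map_intCast] at hfn hfv hgn hgv
  have hf : f v = f v * n * g v := by
    linear_combination (g v * n - 1) * hfv - f v * f v * hgn
  have hg : g v = f v * n * g v := by
    linear_combination (f v * n - 1) * hgv - g v * g v * hfn
  rw [hf, ← hg]

theorem Nat.Primes.finite_setOf_intCast_eq_zero {n : ℤ} (hn : n ≠ 0) :
    {p : Nat.Primes | (n : ZMod p) = 0}.Finite := by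
  refine Set.Finite.of_finite_image (f := fun p : Nat.Primes => (p : ℕ)) ?_
    (fun p _ q _ h => Subtype.ext h)
  refine n.natAbs.divisors.finite_toSet.subset ?_
  rintro _ ⟨p, hp, rfl⟩
  have hd : (p : ℤ) ∣ n := (ZMod.intCast_zmod_eq_zero_iff_dvd n p).1 hp
  simpa [hn] using Int.natCast_dvd.1 hd

/-- The ideal of finitely supported families in `∏_p ℤ/pℤ`. -/
def finiteSupportIdeal : Ideal (∀ p : Nat.Primes, ZMod p) where
  carrier := {a | {p | a p ≠ 0}.Finite}
  zero_mem' := by simp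
  add_mem' {a b} ha hb := (Set.Finite.union ha hb).subset fun p hp => by
    by_contra h
    simp only [Set.mem_union, Set.mem_ofPred_eq, not_or, not_not] at h
    exact hp (by simp [h.1, h.2])
  smul_mem' c a ha := Set.Finite.subset ha fun p hp h => hp (by simp [h])

theorem mem_finiteSupportIdeal {a : ∀ p : Nat.Primes, ZMod p} :
    a ∈ finiteSupportIdeal ↔ {p | a p ≠ 0}.Finite := Iff.rfl

theorem isUnit_intCast_quotient_finiteSupportIdeal {n : ℤ} (hn : n ≠ 0) :
    IsUnit (n : (∀ p : Nat.Primes, ZMod p) ⧸ finiteSupportIdeal) := by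
  refine IsUnit.of_mul_eq_one
    (Ideal.Quotient.mk finiteSupportIdeal fun p : Nat.Primes => (n : ZMod p)⁻¹) ?_
  rw [← map_intCast (Ideal.Quotient.mk finiteSupportIdeal), ← map_mul,
    ← map_one (Ideal.Quotient.mk finiteSupportIdeal), Ideal.Quotient.eq]
  refine (Nat.Primes.finite_setOf_intCast_eq_zero hn).subset fun p hp => ?_
  have : Fact (p : ℕ).Prime := ⟨p.2⟩
  by_contra h
  exact hp (by simp [mul_inv_cancel₀ (show (n : ZMod p) ≠ 0 from h)])

theorem finite_of_forall_map_eq (x : ℚ × ∀ p : Nat.Primes, ZMod p)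
    (hx : ∀ (S : Type) [CommRing S] (f g : (ℚ × ∀ p : Nat.Primes, ZMod p) →+* S), f x = g x) :
    {p : Nat.Primes |
      x.2 p * ((x.1.den : ℤ) : ZMod p) ≠ ((x.1.num : ℤ) : ZMod p)}.Finite := by
  let φ : ℚ →+* (∀ p : Nat.Primes, ZMod p) ⧸ finiteSupportIdeal :=
    IsLocalization.lift (M := nonZeroDivisors ℤ) (g := Int.castRingHom _) fun n =>
      isUnit_intCast_quotient_finiteSupportIdeal (nonZeroDivisors.ne_zero n.2)
  have h := hx _ (φ.comp (RingHom.fst _ _))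
    ((Ideal.Quotient.mk finiteSupportIdeal).comp (RingHom.snd _ _))
  simp only [RingHom.comp_apply, RingHom.coe_fst, RingHom.coe_snd] at h
  have hφ : φ x.1 * ((x.1.den : ℤ) : _) = ((x.1.num : ℤ) : _) := by
    rw [← map_intCast φ, ← map_intCast φ, ← map_mul]
    exact congrArg φ (by simp [Rat.mul_den_eq_num])
  rw [h, ← map_intCast (Ideal.Quotient.mk finiteSupportIdeal),
    ← map_intCast (Ideal.Quotient.mk finiteSupportIdeal), ← map_mul, Ideal.Quotient.eq,
    mem_finiteSupportIdeal] at hφ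
  refine hφ.subset fun p hp => ?_
  simpa [sub_eq_zero] using hp

theorem exists_intCast_eq_on_finset (a : ∀ p : Nat.Primes, ZMod p) (F : Finset Nat.Primes) :
    ∃ k : ℤ, ∀ p ∈ F, (k : ZMod p) = a p := by
  obtain ⟨k, hk⟩ := Nat.chineseRemainderOfFinset (fun p : Nat.Primes => (a p).val)
    (fun p : Nat.Primes => (p : ℕ)) F (fun p _ => p.2.ne_zero) fun p _ q _ hpq =>
      (Nat.coprime_primes p.2 q.2).2 fun h => hpq (Subtype.ext h)
  refine ⟨k, fun p hp => ?_⟩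
  have : NeZero (p : ℕ) := ⟨p.2.ne_zero⟩
  have := (ZMod.natCast_eq_natCast_iff _ _ _).2 (hk p hp)
  rw [Int.cast_natCast, this, ZMod.natCast_zmod_val]

theorem map_eq_map_of_finite (x : ℚ × ∀ p : Nat.Primes, ZMod p)
    (hx : {p : Nat.Primes |
      x.2 p * ((x.1.den : ℤ) : ZMod p) ≠ ((x.1.num : ℤ) : ZMod p)}.Finite)
    {S : Type*} [CommRing S] (f g : (ℚ × ∀ p : Nat.Primes, ZMod p) →+* S) : f x = g x := by
  obtain ⟨m, hm, hbad⟩ : ∃ m : ℤ, m ≠ 0 ∧ ∀ p : Nat.Primes, (m : ZMod p) ≠ 0 →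
      x.2 p * ((x.1.den : ℤ) : ZMod p) = ((x.1.num : ℤ) : ZMod p) := by
    refine ⟨∏ p ∈ hx.toFinset, ((p : ℕ) : ℤ),
      Finset.prod_ne_zero_iff.2 fun p _ => by exact_mod_cast p.2.ne_zero, fun p hp => ?_⟩
    by_contra h
    refine hp ((ZMod.intCast_zmod_eq_zero_iff_dvd _ _).2 ?_)
    exact Finset.dvd_prod_of_mem (fun p : Nat.Primes => ((p : ℕ) : ℤ)) (hx.mem_toFinset.2 h)
  have hd : (x.1.den : ℤ) ≠ 0 := by exact_mod_cast x.1.den_nz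
  obtain ⟨n, hn⟩ : ∃ n : ℤ, n = x.1.den * m := ⟨_, rfl⟩
  have hn0 : n ≠ 0 := hn ▸ mul_ne_zero hd hm
  have hnQ : (n : ℚ) ≠ 0 := by exact_mod_cast hn0
  obtain ⟨k, hk⟩ := exists_intCast_eq_on_finset x.2
    (Nat.Primes.finite_setOf_intCast_eq_zero hn0).toFinset
  let v : ℚ × ∀ p : Nat.Primes, ZMod p := ((n : ℚ)⁻¹, fun p => (n : ZMod p)⁻¹)
  have hfield (p : Nat.Primes) : Fact (p : ℕ).Prime := ⟨p.2⟩
  have hv : f v = g v := by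
    refine map_eq_map_of_weak_inverse f g n v ?_ ?_
    · refine Prod.ext ?_ (funext fun p => ?_)
      · simp [v, hnQ]
      · simp [v]
    · refine Prod.ext ?_ (funext fun p => ?_)
      · simp [v, hnQ]
      · by_cases h : (n : ZMod p) = 0 <;> simp [v, h]
  have hxv : x = k + ((x.1.num * m - k * n : ℤ) : ℚ × ∀ p : Nat.Primes, ZMod p) * v := by
    refine Prod.ext ?_ (funext fun p => ?_)
    · have hq : x.1 * n = x.1.num * m := by
        rw [hn]; push_cast; rw [← mul_assoc, Rat.mul_den_eq_num]
      have : x.1 = k + (x.1.num * m - k * n) * (n : ℚ)⁻¹ := by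
        field_simp
        linear_combination hq
      simpa [v] using this
    · have : x.2 p = k + (x.1.num * m - k * n) * (n : ZMod p)⁻¹ := by
        by_cases h : (n : ZMod p) = 0
        · simp [h, hk p (by simpa using h)]
        · have hmp : (m : ZMod p) ≠ 0 := fun h0 => h (by simp [hn, h0])
          have hq : x.2 p * n = x.1.num * m := by
            rw [← hbad p hmp, hn]; push_cast; ring
          field_simp
          linear_combination hq
      simpa [v] using this
  rw [hxv]
  simp only [map_add, map_mul, map_intCast, hv]

/-- Let `R = ℚ × ∏_p ℤ/pℤ`, the product over all primes `p`. An element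
`x = (q, (a_p)_p)` of `R` is absolute if and only if, writing `q = r / s` with `r = q.num` and
`s = q.den ≠ 0`, the set of primes `p` with `a_p * (s mod p) ≠ (r mod p)` is finite;
equivalently, `a_p` equals `r / s` modulo `p` for all but finitely many primes `p`. -/
theorem core_rat_prod_zmod (x : ℚ × ∀ p : Nat.Primes, ZMod p) :
    (∀ (S : Type) [CommRing S]
        (f g : (ℚ × ∀ p : Nat.Primes, ZMod p) →+* S), f x = g x) ↔
      {p : Nat.Primes |
        x.2 p * ((x.1.den : ℤ) : ZMod p) ≠ ((x.1.num : ℤ) : ZMod p)}.Finite := by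
  exact ⟨finite_of_forall_map_eq x, fun h _ _ f g => map_eq_map_of_finite x h f g⟩
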